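/- arXiv:0804.4310 — 12 statements merged into one kernel-verified Lean document; each statement's English description precedes it below -/
import Mathlib

section
/- Let a < b be real numbers and let f : [a,b] → ℝ be continuous on [a,b] and differentiable on (a,b) with |f'(s)| ≤ M for all s ∈ (a,b). Then for every x ∈ [a,b], |f(x) − (1/(b−a))·∫_a^b f(s) ds| ≤ (1/4 + (x − (a+b)/2)²/(b−a)²)·(b−a)·M. -/
/-- A bound on the derivative in the interior of an interval bounds the increments on the
closed interval. -/
theorem abs_sub_le_of_abs_hasDerivAt_le {a b M : ℝ} {f f' : ℝ → ℝ}
    (hcont : ContinuousOn f (Set.Icc a b))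
    (hderiv : ∀ s ∈ Set.Ioo a b, HasDerivAt f (f' s) s)
    (hbound : ∀ s ∈ Set.Ioo a b, |f' s| ≤ M)
    {y z : ℝ} (hay : a ≤ y) (hyz : y ≤ z) (hzb : z ≤ b) :
    |f z - f y| ≤ M * (z - y) := by
  rcases hyz.eq_or_lt with rfl | hlt
  · simp
  obtain ⟨c, hc, hslope⟩ := exists_hasDerivAt_eq_slope f f' hlt
    (hcont.mono (Set.Icc_subset_Icc hay hzb))
    (fun s hs => hderiv s (Set.Ioo_subset_Ioo hay hzb hs))
  have hpos : 0 < z - y := sub_pos.2 hlt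
  have h := hbound c (Set.Ioo_subset_Ioo hay hzb hc)
  rwa [hslope, abs_div, abs_of_pos hpos, div_le_iff₀ hpos] at h

/-- Classical Ostrowski inequality on the real line. -/
theorem ostrowski_inequality (a b M : ℝ) (hab : a < b) (f f' : ℝ → ℝ)
    (hcont : ContinuousOn f (Set.Icc a b))
    (hderiv : ∀ s ∈ Set.Ioo a b, HasDerivAt f (f' s) s)
    (hbound : ∀ s ∈ Set.Ioo a b, |f' s| ≤ M)
    (x : ℝ) (hx : x ∈ Set.Icc a b) :
    |f x - (1 / (b - a)) * ∫ s in a..b, f s| ≤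
      (1 / 4 + (x - (a + b) / 2) ^ 2 / (b - a) ^ 2) * (b - a) * M := by
  obtain ⟨hax, hxb⟩ := hx
  have hpos : 0 < b - a := sub_pos.2 hab
  have hleft : IntervalIntegrable f MeasureTheory.volume a x :=
    (hcont.mono (Set.Icc_subset_Icc_right hxb)).intervalIntegrable_of_Icc hax
  have hright : IntervalIntegrable f MeasureTheory.volume x b :=
    (hcont.mono (Set.Icc_subset_Icc_left hax)).intervalIntegrable_of_Icc hxb
  have hL : |∫ s in a..x, (f x - f s)| ≤ ∫ s in a..x, M * (x - s) := by
    rw [← Real.norm_eq_abs]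
    exact intervalIntegral.norm_integral_le_of_norm_le hax
      (Filter.Eventually.of_forall fun s hs =>
        abs_sub_le_of_abs_hasDerivAt_le hcont hderiv hbound hs.1.le hs.2 hxb)
      (Continuous.intervalIntegrable (u := fun s => M * (x - s)) (by fun_prop) _ _)
  have hR : |∫ s in x..b, (f x - f s)| ≤ ∫ s in x..b, M * (s - x) := by
    rw [← Real.norm_eq_abs]
    exact intervalIntegral.norm_integral_le_of_norm_le hxb
      (Filter.Eventually.of_forall fun s hs => by
        rw [Real.norm_eq_abs, abs_sub_comm]
        exact abs_sub_le_of_abs_hasDerivAt_le hcont hderiv hbound hax hs.1.le hs.2)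
      (Continuous.intervalIntegrable (u := fun s => M * (s - x)) (by fun_prop) _ _)
  have hLval : ∫ s in a..x, M * (x - s) = M * ((x - a) ^ 2 / 2) := by
    rw [intervalIntegral.integral_const_mul, intervalIntegral.integral_sub (by simp) (by simp)]
    simp only [intervalIntegral.integral_const, integral_id, smul_eq_mul]
    ring
  have hRval : ∫ s in x..b, M * (s - x) = M * ((b - x) ^ 2 / 2) := by
    rw [intervalIntegral.integral_const_mul, intervalIntegral.integral_sub (by simp) (by simp)]
    simp only [intervalIntegral.integral_const, integral_id, smul_eq_mul]
    ring
  rw [hLval, intervalIntegral.integral_sub (by simp) hleft,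
    intervalIntegral.integral_const, smul_eq_mul] at hL
  rw [hRval, intervalIntegral.integral_sub (by simp) hright,
    intervalIntegral.integral_const, smul_eq_mul] at hR
  have hsplit := intervalIntegral.integral_add_adjacent_intervals hleft hright
  have hlhs : f x - 1 / (b - a) * ∫ s in a..b, f s =
      (((x - a) * f x - ∫ s in a..x, f s) + ((b - x) * f x - ∫ s in x..b, f s)) / (b - a) := by
    rw [← hsplit]
    field_simp
    ring
  have hrhs : (1 / 4 + (x - (a + b) / 2) ^ 2 / (b - a) ^ 2) * (b - a) * M =
      (M * ((x - a) ^ 2 / 2) + M * ((b - x) ^ 2 / 2)) / (b - a) := by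
    field_simp
    ring
  rw [hlhs, hrhs, abs_div, abs_of_pos hpos]
  gcongr
  exact (abs_add_le _ _).trans (add_le_add hL hR)
end

section
/- For every real constant c < 1/4 there exist real numbers a < b, a function f : [a,b] → ℝ continuous on [a,b] and differentiable on (a,b) with bounded derivative, a bound M with |f'(s)| ≤ M on (a,b), and a point x ∈ [a,b] such that |f(x) − (1/(b−a))·∫_a^b f(s) ds| > (c + (x − (a+b)/2)²/(b−a)²)·(b−a)·M. In other words, the constant 1/4 in the Ostrowski inequality cannot be replaced by any smaller constant. -/
/-- Sharpness of the constant 1/4 in the classical Ostrowski inequality. -/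
theorem ostrowski_inequality_sharp (c : ℝ) (hc : c < 1 / 4) :
    ∃ (a b M x : ℝ) (f f' : ℝ → ℝ), a < b ∧
      ContinuousOn f (Set.Icc a b) ∧
      (∀ s ∈ Set.Ioo a b, HasDerivAt f (f' s) s) ∧
      (∀ s ∈ Set.Ioo a b, |f' s| ≤ M) ∧
      x ∈ Set.Icc a b ∧
      |f x - (1 / (b - a)) * ∫ s in a..b, f s| >
        (c + (x - (a + b) / 2) ^ 2 / (b - a) ^ 2) * (b - a) * M := by
  refine ⟨0, 1, 1, 1, fun t => t, fun _ => 1, one_pos, continuousOn_id,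
    fun s _ => hasDerivAt_id s, fun s _ => by simp, by simp, ?_⟩
  rw [integral_id]
  norm_num [abs_of_pos]
  linarith
end

section
/- Let a < b be real numbers, λ ∈ [0,1], and let f : [a,b] → ℝ be continuously differentiable on [a,b]. Then for every t ∈ [a + λ(b−a)/2, b − λ(b−a)/2], (1−λ)·f(t) + λ·(f(a)+f(b))/2 = (1/(b−a))·∫_a^b f(s) ds + (1/(b−a))·( ∫_a^t (s − (a + λ(b−a)/2))·f'(s) ds + ∫_t^b (s − (b − λ(b−a)/2))·f'(s) ds ). -/
open Set in
/-- Integration by parts against an affine function with slope one. -/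
theorem integral_sub_const_mul_deriv {f f' : ℝ → ℝ} {u v : ℝ} (huv : u ≤ v)
    (hderiv : ∀ s ∈ Icc u v, HasDerivWithinAt f (f' s) (Icc u v) s)
    (hcont : ContinuousOn f' (Icc u v)) (c : ℝ) :
    ∫ s in u..v, (s - c) * f' s = (v - c) * f v - (u - c) * f u - ∫ s in u..v, f s := by
  rw [← uIcc_of_le huv] at hderiv hcont
  simpa using intervalIntegral.integral_mul_deriv_eq_deriv_mul_of_hasDerivWithinAt
    (u := fun s => s - c) (u' := fun _ => 1)
    (fun x _ => ((hasDerivAt_id x).sub_const c).hasDerivWithinAt) hderiv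
    intervalIntegrable_const hcont.intervalIntegrable

/-- Generalized Montgomery identity on the real line. -/
theorem generalized_montgomery_identity (a b l : ℝ) (hab : a < b)
    (hl : l ∈ Set.Icc (0 : ℝ) 1) (f f' : ℝ → ℝ)
    (hderiv : ∀ s ∈ Set.Icc a b, HasDerivWithinAt f (f' s) (Set.Icc a b) s)
    (hcont : ContinuousOn f' (Set.Icc a b))
    (t : ℝ) (ht : t ∈ Set.Icc (a + l * (b - a) / 2) (b - l * (b - a) / 2)) :
    (1 - l) * f t + l * (f a + f b) / 2 =
      (1 / (b - a)) * (∫ s in a..b, f s) +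
      (1 / (b - a)) * ((∫ s in a..t, (s - (a + l * (b - a) / 2)) * f' s) +
        ∫ s in t..b, (s - (b - l * (b - a) / 2)) * f' s) := by
  obtain ⟨hl0, -⟩ := hl
  have hpos : 0 < b - a := sub_pos.2 hab
  have hshift : 0 ≤ l * (b - a) / 2 := by positivity
  have hat : a ≤ t := by linarith [ht.1]
  have htb : t ≤ b := by linarith [ht.2]
  have hleft : Set.Icc a t ⊆ Set.Icc a b := Set.Icc_subset_Icc_right htb
  have hright : Set.Icc t b ⊆ Set.Icc a b := Set.Icc_subset_Icc_left hat
  have hf : ContinuousOn f (Set.Icc a b) := fun s hs => (hderiv s hs).continuousWithinAt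
  rw [integral_sub_const_mul_deriv hat (fun s hs => (hderiv s (hleft hs)).mono hleft)
      (hcont.mono hleft),
    integral_sub_const_mul_deriv htb (fun s hs => (hderiv s (hright hs)).mono hright)
      (hcont.mono hright),
    ← intervalIntegral.integral_add_adjacent_intervals
      ((hf.mono hleft).intervalIntegrable_of_Icc hat)
      ((hf.mono hright).intervalIntegrable_of_Icc htb)]
  field_simp
  ring
end

section
/- Let n ≥ 1 be a natural number, x₀, x₁, …, x_n real numbers, λ ∈ [0,1], and let i be an integer with λn/2 ≤ i ≤ n − λn/2 and 1 ≤ i ≤ n. Then (1−λ)·x_i + λ·(x₀+x_n)/2 = (1/n)·∑_{j=1}^{n} x_j + (1/n)·( ∑_{j=0}^{i−1} (j − nλ/2)·(x_{j+1} − x_j) + ∑_{j=i}^{n−1} (j − (n − nλ/2))·(x_{j+1} − x_j) ). -/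
/-- Summation by parts against the affine weight `j - c`. -/
theorem sum_range_sub_const_mul_forward_diff (x : ℕ → ℝ) (c : ℝ) (m : ℕ) :
    ∑ j ∈ Finset.range m, ((j : ℝ) - c) * (x (j + 1) - x j) =
      (m - c) * x m + c * x 0 - ∑ j ∈ Finset.Icc 1 m, x j := by
  induction m with
  | zero => simp
  | succ m ih =>
    rw [Finset.sum_range_succ, ih, Finset.sum_Icc_succ_top (by omega)]
    push_cast
    ring

/-- Discrete generalized Montgomery identity. -/
theorem discrete_generalized_montgomery_identity (n : ℕ) (hn : 1 ≤ n)
    (x : ℕ → ℝ) (l : ℝ) (hl : l ∈ Set.Icc (0 : ℝ) 1) (i : ℕ)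
    (hi₁ : l * n / 2 ≤ (i : ℝ)) (hi₂ : (i : ℝ) ≤ n - l * n / 2)
    (hi₃ : 1 ≤ i) (hi₄ : i ≤ n) :
    (1 - l) * x i + l * (x 0 + x n) / 2 =
      (1 / (n : ℝ)) * ∑ j ∈ Finset.Icc 1 n, x j +
      (1 / (n : ℝ)) *
        ((∑ j ∈ Finset.range i, ((j : ℝ) - n * l / 2) * (x (j + 1) - x j)) +
          ∑ j ∈ Finset.Ico i n, ((j : ℝ) - (n - n * l / 2)) * (x (j + 1) - x j)) := by
  have hn₀ : (n : ℝ) ≠ 0 := by exact_mod_cast (by omega : n ≠ 0)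
  rw [Finset.sum_Ico_eq_sub _ hi₄]
  simp only [sum_range_sub_const_mul_forward_diff]
  field_simp
  ring
end

section
/- Let q > 1 be a real number, m < n natural numbers, λ ∈ [0,1], f : ℝ → ℝ, and let j be an integer with m ≤ j ≤ n such that q^m + λ(q^n − q^m)/2 ≤ q^j ≤ q^n − λ(q^n − q^m)/2. Then (1−λ)·f(q^j) + λ·(f(q^m)+f(q^n))/2 = ( ∑_{k=m}^{n−1} q^k·f(q^{k+1}) )/( ∑_{k=m}^{n−1} q^k ) + (1/(q^n − q^m))·( ∑_{k=m}^{j−1} (f(q^{k+1}) − f(q^k))·(q^k − (q^m + λ(q^n − q^m)/2)) + ∑_{k=j}^{n−1} (f(q^{k+1}) − f(q^k))·(q^k − (q^n − λ(q^n − q^m)/2)) ). -/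
/-- Summation by parts on the lattice `q ^ ℕ`, against the affine function `x ↦ x - c`. -/
theorem sum_Ico_qdiff_mul_sub {R : Type*} [CommRing R] (q c : R) (F : ℕ → R) {a b : ℕ}
    (hab : a ≤ b) :
    ∑ k ∈ Finset.Ico a b, (F (k + 1) - F k) * (q ^ k - c) =
      F b * (q ^ b - c) - F a * (q ^ a - c) -
        (q - 1) * ∑ k ∈ Finset.Ico a b, q ^ k * F (k + 1) := by
  rw [← Finset.sum_Ico_sub (fun k => F k * (q ^ k - c)) hab, Finset.mul_sum,
    ← Finset.sum_sub_distrib]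
  refine Finset.sum_congr rfl fun k _ => ?_
  ring

/-- Quantum-calculus generalized Montgomery identity. -/
theorem qcalc_generalized_montgomery_identity (q : ℝ) (hq : 1 < q)
    (m n : ℕ) (hmn : m < n) (l : ℝ) (hl : l ∈ Set.Icc (0 : ℝ) 1)
    (f : ℝ → ℝ) (j : ℕ) (hj₁ : m ≤ j) (hj₂ : j ≤ n)
    (hj₃ : q ^ m + l * (q ^ n - q ^ m) / 2 ≤ q ^ j)
    (hj₄ : q ^ j ≤ q ^ n - l * (q ^ n - q ^ m) / 2) :
    (1 - l) * f (q ^ j) + l * (f (q ^ m) + f (q ^ n)) / 2 =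
      (∑ k ∈ Finset.Ico m n, q ^ k * f (q ^ (k + 1))) /
        (∑ k ∈ Finset.Ico m n, q ^ k) +
      (1 / (q ^ n - q ^ m)) *
        ((∑ k ∈ Finset.Ico m j,
            (f (q ^ (k + 1)) - f (q ^ k)) * (q ^ k - (q ^ m + l * (q ^ n - q ^ m) / 2))) +
          ∑ k ∈ Finset.Ico j n,
            (f (q ^ (k + 1)) - f (q ^ k)) * (q ^ k - (q ^ n - l * (q ^ n - q ^ m) / 2))) := by
  have hq₁ : q - 1 ≠ 0 := sub_ne_zero.mpr hq.ne'
  have hD : q ^ n - q ^ m ≠ 0 := sub_ne_zero.mpr (pow_lt_pow_right₀ hq hmn).ne'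
  rw [geom_sum_Ico hq.ne' hmn.le,
    sum_Ico_qdiff_mul_sub q _ (fun k => f (q ^ k)) hj₁,
    sum_Ico_qdiff_mul_sub q _ (fun k => f (q ^ k)) hj₂,
    ← Finset.sum_Ico_consecutive (fun k => q ^ k * f (q ^ (k + 1))) hj₁ hj₂]
  field_simp
  ring
end

section
/- Let a < b be real numbers, λ ∈ [0,1], and let f : [a,b] → ℝ be continuous on [a,b] and differentiable on (a,b) with |f'(s)| ≤ M for all s ∈ (a,b). Then for every t ∈ [a + λ(b−a)/2, b − λ(b−a)/2], |(1−λ)·f(t) + λ·(f(a)+f(b))/2 − (1/(b−a))·∫_a^b f(s) ds| ≤ M·( (1/4)·(b−a)·((1−λ)² + λ²) + (1/(b−a))·(t − (a+b)/2)² ). -/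
open Set MeasureTheory in
theorem abs_integral_sub_left_endpoint_le {f : ℝ → ℝ} {M u v : ℝ} (huv : u ≤ v)
    (hf : ContinuousOn f (Icc u v))
    (hlip : ∀ s ∈ Icc u v, |f s - f u| ≤ M * (s - u)) :
    |(∫ s in u..v, f s) - (v - u) * f u| ≤ M * (v - u) ^ 2 / 2 := by
  have hint : IntervalIntegrable f volume u v := hf.intervalIntegrable_of_Icc huv
  have hsub : (∫ s in u..v, f s) - (v - u) * f u = ∫ s in u..v, (f s - f u) := by
    rw [intervalIntegral.integral_sub hint (by simp), intervalIntegral.integral_const, smul_eq_mul]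
  have hval : ∫ s in u..v, M * (s - u) = M * (v - u) ^ 2 / 2 := by
    rw [intervalIntegral.integral_const_mul, intervalIntegral.integral_sub (by simp) (by simp),
      integral_id, intervalIntegral.integral_const, smul_eq_mul]
    ring
  rw [hsub, ← hval, ← Real.norm_eq_abs]
  exact intervalIntegral.norm_integral_le_of_norm_le huv
    (Filter.Eventually.of_forall fun s hs => hlip s (Ioc_subset_Icc_self hs))
    (Continuous.intervalIntegrable (by fun_prop) _ _)

open Set MeasureTheory in
theorem abs_integral_sub_right_endpoint_le {f : ℝ → ℝ} {M u v : ℝ} (huv : u ≤ v)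
    (hf : ContinuousOn f (Icc u v))
    (hlip : ∀ s ∈ Icc u v, |f v - f s| ≤ M * (v - s)) :
    |(∫ s in u..v, f s) - (v - u) * f v| ≤ M * (v - u) ^ 2 / 2 := by
  have hneg : ContinuousOn (fun s => f (-s)) (Icc (-v) (-u)) :=
    hf.comp continuousOn_neg fun s hs => ⟨by linarith [hs.2], by linarith [hs.1]⟩
  have h := abs_integral_sub_left_endpoint_le (M := M) (neg_le_neg huv) hneg fun s hs => by
    have := hlip (-s) ⟨by linarith [hs.2], by linarith [hs.1]⟩
    rw [abs_sub_comm] at this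
    rw [neg_neg]
    convert this using 2
    ring
  rw [intervalIntegral.integral_comp_neg] at h
  simp only [neg_neg] at h
  convert h using 2 <;> ring

open Set in
theorem abs_sub_le_of_hasDerivAt_Ioo {f f' : ℝ → ℝ} {a b M : ℝ}
    (hcont : ContinuousOn f (Icc a b))
    (hderiv : ∀ s ∈ Ioo a b, HasDerivAt f (f' s) s)
    (hbound : ∀ s ∈ Ioo a b, |f' s| ≤ M) {x y : ℝ} (hax : a ≤ x) (hxy : x ≤ y) (hyb : y ≤ b) :
    |f y - f x| ≤ M * (y - x) := by
  rcases hxy.eq_or_lt with rfl | hlt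
  · simp
  have hsub : Ioo x y ⊆ Ioo a b := Ioo_subset_Ioo hax hyb
  obtain ⟨c, hc, hslope⟩ := exists_hasDerivAt_eq_slope f f' hlt
    (hcont.mono (Icc_subset_Icc hax hyb)) fun s hs => hderiv s (hsub hs)
  have hpos : 0 < y - x := sub_pos.2 hlt
  have h := hbound c (hsub hc)
  rwa [hslope, abs_div, abs_of_pos hpos, div_le_iff₀ hpos] at h


/-- Generalized Ostrowski type inequality on the real line. -/
theorem generalized_ostrowski_inequality (a b l M : ℝ) (hab : a < b)
    (hl : l ∈ Set.Icc (0 : ℝ) 1) (f f' : ℝ → ℝ)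
    (hcont : ContinuousOn f (Set.Icc a b))
    (hderiv : ∀ s ∈ Set.Ioo a b, HasDerivAt f (f' s) s)
    (hbound : ∀ s ∈ Set.Ioo a b, |f' s| ≤ M)
    (t : ℝ) (ht : t ∈ Set.Icc (a + l * (b - a) / 2) (b - l * (b - a) / 2)) :
    |(1 - l) * f t + l * (f a + f b) / 2 - (1 / (b - a)) * ∫ s in a..b, f s| ≤
      M * ((1 / 4) * (b - a) * ((1 - l) ^ 2 + l ^ 2) +
        (1 / (b - a)) * (t - (a + b) / 2) ^ 2) := by
  obtain ⟨hl0, hl1⟩ := hl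
  obtain ⟨htp, htq⟩ := ht
  have hL : 0 < b - a := sub_pos.2 hab
  have hh : 0 ≤ l * (b - a) / 2 := by positivity
  set p := a + l * (b - a) / 2 with hp
  set q := b - l * (b - a) / 2 with hq
  have hap : a ≤ p := by linarith
  have hqb : q ≤ b := by linarith
  have hlip {x y : ℝ} (hax : a ≤ x) (hxy : x ≤ y) (hyb : y ≤ b) : |f y - f x| ≤ M * (y - x) :=
    abs_sub_le_of_hasDerivAt_Ioo hcont hderiv hbound hax hxy hyb
  have hsub {x y : ℝ} (hax : a ≤ x) (hyb : y ≤ b) : ContinuousOn f (Set.Icc x y) :=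
    hcont.mono (Set.Icc_subset_Icc hax hyb)
  have hint {x y : ℝ} (hax : a ≤ x) (hxy : x ≤ y) (hyb : y ≤ b) :
      IntervalIntegrable f MeasureTheory.volume x y :=
    (hsub hax hyb).intervalIntegrable_of_Icc hxy
  have h₁ := abs_integral_sub_left_endpoint_le hap (hsub le_rfl (by linarith))
    fun s hs => hlip le_rfl hs.1 (by linarith [hs.2])
  have h₂ := abs_integral_sub_right_endpoint_le htp (hsub hap (by linarith))
    fun s hs => hlip (by linarith [hs.1]) hs.2 (by linarith)
  have h₃ := abs_integral_sub_left_endpoint_le htq (hsub (by linarith) hqb)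
    fun s hs => hlip (by linarith) hs.1 (by linarith [hs.2])
  have h₄ := abs_integral_sub_right_endpoint_le hqb (hsub (by linarith) le_rfl)
    fun s hs => hlip (by linarith [hs.1]) hs.2 le_rfl
  have hsplit : ∫ s in a..b, f s = (∫ s in a..p, f s) + (∫ s in p..t, f s) +
      (∫ s in t..q, f s) + ∫ s in q..b, f s := by
    rw [intervalIntegral.integral_add_adjacent_intervals
        (hint le_rfl hap (by linarith)) (hint hap htp (by linarith)),
      intervalIntegral.integral_add_adjacent_intervals
        (hint le_rfl (by linarith) (by linarith)) (hint (by linarith) htq hqb),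
      intervalIntegral.integral_add_adjacent_intervals
        (hint le_rfl (by linarith) hqb) (hint (by linarith) hqb le_rfl)]
  have hleft : (1 - l) * f t + l * (f a + f b) / 2 - (1 / (b - a)) * ∫ s in a..b, f s =
      ((p - a) * f a + (t - p) * f t + (q - t) * f t + (b - q) * f b - ∫ s in a..b, f s) /
        (b - a) := by
    rw [hp, hq]
    field_simp
    ring
  have hright : M * ((1 / 4) * (b - a) * ((1 - l) ^ 2 + l ^ 2) +
      (1 / (b - a)) * (t - (a + b) / 2) ^ 2) =
      (M * (p - a) ^ 2 / 2 + M * (t - p) ^ 2 / 2 + M * (q - t) ^ 2 / 2 + M * (b - q) ^ 2 / 2) /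
        (b - a) := by
    rw [hp, hq]
    field_simp
    ring
  rw [hleft, hright, abs_div, abs_of_pos hL, hsplit]
  gcongr
  rw [abs_le] at h₁ h₂ h₃ h₄ ⊢
  constructor <;> linarith
end

section
/- Let a < b be real numbers and let f : [a,b] → ℝ be continuous on [a,b] and differentiable on (a,b) with |f'(s)| ≤ M for all s ∈ (a,b). Then |(f(a)+f(b))/2 − (1/(b−a))·∫_a^b f(s) ds| ≤ M·(b−a)/4. -/
/-- Mean value inequality from a bound on the derivative in the open interval only. -/
theorem abs_sub_le_mul_of_hasDerivAt_Ioo {a b M : ℝ} {f f' : ℝ → ℝ}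
    (hcont : ContinuousOn f (Set.Icc a b))
    (hderiv : ∀ s ∈ Set.Ioo a b, HasDerivAt f (f' s) s)
    (hbound : ∀ s ∈ Set.Ioo a b, |f' s| ≤ M)
    {x y : ℝ} (hax : a ≤ x) (hxy : x ≤ y) (hyb : y ≤ b) :
    |f y - f x| ≤ M * (y - x) := by
  rcases hxy.eq_or_lt with rfl | hlt
  · simp
  have hsub : Set.Ioo x y ⊆ Set.Ioo a b := Set.Ioo_subset_Ioo hax hyb
  obtain ⟨c, hc, hslope⟩ := exists_hasDerivAt_eq_slope f f' hlt
    (hcont.mono (Set.Icc_subset_Icc hax hyb)) fun s hs => hderiv s (hsub hs)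
  have hpos : 0 < y - x := sub_pos.2 hlt
  rw [eq_div_iff hpos.ne'] at hslope
  rw [← hslope, abs_mul, abs_of_pos hpos]
  exact mul_le_mul_of_nonneg_right (hbound c (hsub hc)) hpos.le

/-- A function growing at most linearly from `f a` has integral close to that of the constant. -/
theorem abs_mul_sub_integral_le_of_left {a m M : ℝ} {f : ℝ → ℝ} (ham : a ≤ m)
    (hf : IntervalIntegrable f MeasureTheory.volume a m)
    (h : ∀ s ∈ Set.Icc a m, |f s - f a| ≤ M * (s - a)) :
    |(m - a) * f a - ∫ s in a..m, f s| ≤ M * (m - a) ^ 2 / 2 := by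
  have hle := intervalIntegral.norm_integral_le_of_norm_le (μ := MeasureTheory.volume)
    (f := fun s => f s - f a) (g := fun s => M * (s - a)) ham
    (.of_forall fun s hs => h s (Set.Ioc_subset_Icc_self hs))
    (Continuous.intervalIntegrable (by fun_prop) _ _)
  rw [intervalIntegral.integral_sub hf intervalIntegrable_const,
    intervalIntegral.integral_const, Real.norm_eq_abs, abs_sub_comm, smul_eq_mul,
    intervalIntegral.integral_const_mul,
    intervalIntegral.integral_comp_sub_right (fun s => s), integral_id] at hle
  exact hle.trans_eq (by ring)

/-- The mirror image of `abs_mul_sub_integral_le_of_left`. -/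
theorem abs_mul_sub_integral_le_of_right {m b M : ℝ} {f : ℝ → ℝ} (hmb : m ≤ b)
    (hf : IntervalIntegrable f MeasureTheory.volume m b)
    (h : ∀ s ∈ Set.Icc m b, |f b - f s| ≤ M * (b - s)) :
    |(b - m) * f b - ∫ s in m..b, f s| ≤ M * (b - m) ^ 2 / 2 := by
  have hle := intervalIntegral.norm_integral_le_of_norm_le (μ := MeasureTheory.volume)
    (f := fun s => f b - f s) (g := fun s => M * (b - s)) hmb
    (.of_forall fun s hs => h s (Set.Ioc_subset_Icc_self hs))
    (Continuous.intervalIntegrable (by fun_prop) _ _)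
  rw [intervalIntegral.integral_sub intervalIntegrable_const hf,
    intervalIntegral.integral_const, Real.norm_eq_abs, smul_eq_mul,
    intervalIntegral.integral_const_mul,
    intervalIntegral.integral_comp_sub_left (fun s => s), integral_id] at hle
  exact hle.trans_eq (by ring)

/-- Trapezoid inequality on the real line. -/
theorem trapezoid_inequality (a b M : ℝ) (hab : a < b) (f f' : ℝ → ℝ)
    (hcont : ContinuousOn f (Set.Icc a b))
    (hderiv : ∀ s ∈ Set.Ioo a b, HasDerivAt f (f' s) s)
    (hbound : ∀ s ∈ Set.Ioo a b, |f' s| ≤ M) :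
    |(f a + f b) / 2 - (1 / (b - a)) * ∫ s in a..b, f s| ≤ M * (b - a) / 4 := by
  obtain ⟨m, hm⟩ : ∃ m, m = (a + b) / 2 := ⟨_, rfl⟩
  have ham : a ≤ m := by linarith
  have hmb : m ≤ b := by linarith
  have hba : 0 < b - a := sub_pos.2 hab
  have hint_left : IntervalIntegrable f MeasureTheory.volume a m :=
    (hcont.mono (Set.Icc_subset_Icc_right hmb)).intervalIntegrable_of_Icc ham
  have hint_right : IntervalIntegrable f MeasureTheory.volume m b :=
    (hcont.mono (Set.Icc_subset_Icc_left ham)).intervalIntegrable_of_Icc hmb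
  have hleft := abs_mul_sub_integral_le_of_left ham hint_left fun s hs =>
    abs_sub_le_mul_of_hasDerivAt_Ioo hcont hderiv hbound le_rfl hs.1 (hs.2.trans hmb)
  have hright := abs_mul_sub_integral_le_of_right hmb hint_right fun s hs =>
    abs_sub_le_mul_of_hasDerivAt_Ioo hcont hderiv hbound (ham.trans hs.1) hs.2 le_rfl
  have hsplit : (f a + f b) / 2 - (1 / (b - a)) * ∫ s in a..b, f s =
      (((m - a) * f a - ∫ s in a..m, f s) + ((b - m) * f b - ∫ s in m..b, f s)) / (b - a) := by
    rw [← intervalIntegral.integral_add_adjacent_intervals hint_left hint_right, hm]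
    field_simp
    ring
  rw [hsplit, abs_div, abs_of_pos hba, div_le_iff₀ hba]
  refine (abs_add_le _ _).trans ((add_le_add hleft hright).trans_eq ?_)
  rw [hm]
  ring
end

section
/- Let a < b be real numbers and let f : [a,b] → ℝ be continuous on [a,b] and differentiable on (a,b) with |f'(s)| ≤ M for all s ∈ (a,b). Then |(f(a) + 4f((a+b)/2) + f(b))/6 − (1/(b−a))·∫_a^b f(s) ds| ≤ 5M·(b−a)/36. -/
open Set

lemma abs_sub_le_of_abs_deriv_le {a b M : ℝ} {f f' : ℝ → ℝ}
    (hcont : ContinuousOn f (Icc a b))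
    (hderiv : ∀ s ∈ Ioo a b, HasDerivAt f (f' s) s)
    (hbound : ∀ s ∈ Ioo a b, |f' s| ≤ M) {x y : ℝ}
    (hx : x ∈ Icc a b) (hy : y ∈ Icc a b) : |f x - f y| ≤ M * |x - y| := by
  wlog hxy : y ≤ x generalizing x y
  · rw [abs_sub_comm, abs_sub_comm x]
    exact this hy hx (le_of_not_ge hxy)
  rcases hxy.eq_or_lt with rfl | hlt
  · simp
  have hsub : Ioo y x ⊆ Ioo a b := Ioo_subset_Ioo hy.1 hx.2
  obtain ⟨c, hc, hslope⟩ := exists_hasDerivAt_eq_slope f f' hlt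
    (hcont.mono (Icc_subset_Icc hy.1 hx.2)) fun s hs => hderiv s (hsub hs)
  have hpos : 0 < x - y := sub_pos.2 hlt
  rw [eq_div_iff hpos.ne'] at hslope
  rw [← hslope, abs_mul]
  exact mul_le_mul_of_nonneg_right (hbound c (hsub hc)) (abs_nonneg _)

/-- Error of the one-point quadrature rule at the endpoint `c`, in either orientation. -/
lemma abs_integral_sub_mul_le {c v M : ℝ} {f : ℝ → ℝ}
    (hint : IntervalIntegrable f MeasureTheory.volume c v)
    (hf : ∀ s ∈ uIcc c v, |f s - f c| ≤ M * |s - c|) :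
    |(∫ s in c..v, f s) - (v - c) * f c| ≤ M * (v - c) ^ 2 / 2 := by
  have hconst : (∫ s in c..v, f s) - (v - c) * f c = ∫ s in c..v, (f s - f c) := by
    rw [intervalIntegral.integral_sub hint intervalIntegrable_const]
    simp
  have hscale : ∫ s in c..v, (f s - f c) =
      (v - c) * ∫ t in (0 : ℝ)..1, (f (c + (v - c) * t) - f c) := by
    rw [intervalIntegral.mul_integral_comp_add_mul (f := fun s => f s - f c)]
    simp
  have hle : ‖∫ t in (0 : ℝ)..1, (f (c + (v - c) * t) - f c)‖ ≤
      ∫ t in (0 : ℝ)..1, M * |v - c| * t := by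
    refine intervalIntegral.norm_integral_le_of_norm_le zero_le_one
      (Filter.Eventually.of_forall fun t ht => ?_)
      (Continuous.intervalIntegrable (by fun_prop) _ _)
    have hmem : c + (v - c) * t ∈ uIcc c v := by
      rw [← segment_eq_uIcc, segment_eq_image']
      exact ⟨t, ⟨ht.1.le, ht.2⟩, by simp [mul_comm]⟩
    have h := hf _ hmem
    rwa [add_sub_cancel_left, abs_mul, abs_of_pos ht.1, ← mul_assoc] at h
  rw [hconst, hscale, abs_mul]
  calc |v - c| * |∫ t in (0 : ℝ)..1, (f (c + (v - c) * t) - f c)|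
      ≤ |v - c| * ∫ t in (0 : ℝ)..1, M * |v - c| * t :=
        mul_le_mul_of_nonneg_left hle (abs_nonneg _)
    _ = M * (v - c) ^ 2 / 2 := by
        rw [intervalIntegral.integral_const_mul, integral_id, ← sq_abs (v - c)]
        ring

/-- Simpson inequality on the real line. -/
theorem simpson_inequality (a b M : ℝ) (hab : a < b) (f f' : ℝ → ℝ)
    (hcont : ContinuousOn f (Set.Icc a b))
    (hderiv : ∀ s ∈ Set.Ioo a b, HasDerivAt f (f' s) s)
    (hbound : ∀ s ∈ Set.Ioo a b, |f' s| ≤ M) :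
    |(f a + 4 * f ((a + b) / 2) + f b) / 6 - (1 / (b - a)) * ∫ s in a..b, f s| ≤
      5 * M * (b - a) / 36 := by
  have hint : ∀ {x y : ℝ}, x ∈ Icc a b → y ∈ Icc a b →
      IntervalIntegrable f MeasureTheory.volume x y := fun hx hy =>
    (hcont.mono (ordConnected_Icc.uIcc_subset hx hy)).intervalIntegrable
  have hpiece : ∀ {c v : ℝ}, c ∈ Icc a b → v ∈ Icc a b →
      |(∫ s in c..v, f s) - (v - c) * f c| ≤ M * (v - c) ^ 2 / 2 := fun hc hv =>
    abs_integral_sub_mul_le (hint hc hv) fun _ hs =>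
      abs_sub_le_of_abs_deriv_le hcont hderiv hbound (ordConnected_Icc.uIcc_subset hc hv hs) hc
  obtain ⟨p, hp⟩ : ∃ p, p = a + (b - a) / 6 := ⟨_, rfl⟩
  obtain ⟨q, hq⟩ : ∃ q, q = b - (b - a) / 6 := ⟨_, rfl⟩
  obtain ⟨m, hm⟩ : ∃ m, m = (a + b) / 2 := ⟨_, rfl⟩
  rw [← hm]
  have ha : a ∈ Icc a b := ⟨le_rfl, hab.le⟩
  have hb : b ∈ Icc a b := ⟨hab.le, le_rfl⟩
  have hp' : p ∈ Icc a b := ⟨by linarith, by linarith⟩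
  have hq' : q ∈ Icc a b := ⟨by linarith, by linarith⟩
  have hm' : m ∈ Icc a b := ⟨by linarith, by linarith⟩
  have hap := abs_le.1 (hpiece ha hp')
  have hmp := abs_le.1 (hpiece hm' hp')
  have hmq := abs_le.1 (hpiece hm' hq')
  have hbq := abs_le.1 (hpiece hb hq')
  have hsplit : ∫ s in a..b, f s = (∫ s in a..p, f s) - (∫ s in m..p, f s) +
      (∫ s in m..q, f s) - ∫ s in b..q, f s := by
    rw [intervalIntegral.integral_symm p m, intervalIntegral.integral_symm q b, sub_neg_eq_add,
      sub_neg_eq_add, intervalIntegral.integral_add_adjacent_intervals (hint ha hp') (hint hp' hm'),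
      intervalIntegral.integral_add_adjacent_intervals (hint ha hm') (hint hm' hq'),
      intervalIntegral.integral_add_adjacent_intervals (hint ha hq') (hint hq' hb)]
  have hpos : 0 < b - a := sub_pos.2 hab
  have hfactor : (f a + 4 * f m + f b) / 6 - (1 / (b - a)) * ∫ s in a..b, f s =
      ((b - a) * ((f a + 4 * f m + f b) / 6) - ∫ s in a..b, f s) / (b - a) := by
    field_simp
  rw [hfactor, abs_div, abs_of_pos hpos, div_le_iff₀ hpos, hsplit, abs_le]
  subst hp hq hm
  constructor <;> linarith
end

section
/- Let a < b be real numbers and let f : [a,b] → ℝ be continuous on [a,b] and differentiable on (a,b) with |f'(s)| ≤ M for all s ∈ (a,b). Then |(1/2)·((f(a)+f(b))/2 + f((a+b)/2)) − (1/(b−a))·∫_a^b f(s) ds| ≤ M·(b−a)/8. -/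
/-- Mean value inequality for a function continuous on a closed interval whose derivative is
bounded by `M` in the interior. -/
lemma abs_sub_le_mul_of_abs_hasDerivAt_le {a b M : ℝ} {f f' : ℝ → ℝ}
    (hcont : ContinuousOn f (Set.Icc a b))
    (hderiv : ∀ s ∈ Set.Ioo a b, HasDerivAt f (f' s) s)
    (hbound : ∀ s ∈ Set.Ioo a b, |f' s| ≤ M) {x y : ℝ} (hx : a ≤ x) (hxy : x ≤ y)
    (hy : y ≤ b) : |f y - f x| ≤ M * (y - x) := by
  rcases hxy.eq_or_lt with rfl | hlt
  · simp
  · obtain ⟨c, hc, hslope⟩ := exists_hasDerivAt_eq_slope f f' hlt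
      (hcont.mono (Set.Icc_subset_Icc hx hy))
      (fun s hs => hderiv s ⟨hx.trans_lt hs.1, hs.2.trans_le hy⟩)
    have hpos : 0 < y - x := sub_pos.2 hlt
    have hM := hbound c ⟨hx.trans_lt hc.1, hc.2.trans_le hy⟩
    rwa [hslope, abs_div, abs_of_pos hpos, div_le_iff₀ hpos] at hM

/-- An affine pointwise bound on `|f - A|` integrates to a bound on `|∫ f - A * (d - c)|`. -/
lemma abs_integral_sub_const_le_of_affine_bound {c d A u v : ℝ} {f : ℝ → ℝ} (hcd : c ≤ d)
    (hcont : ContinuousOn f (Set.Icc c d))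
    (hf : ∀ s ∈ Set.Icc c d, |f s - A| ≤ u * s + v) :
    |(∫ s in c..d, f s) - A * (d - c)| ≤ u * ((d ^ 2 - c ^ 2) / 2) + v * (d - c) := by
  have hfi : IntervalIntegrable f MeasureTheory.volume c d :=
    hcont.intervalIntegrable_of_Icc hcd
  have haff : ∫ s in c..d, (u * s + v) = u * ((d ^ 2 - c ^ 2) / 2) + v * (d - c) := by
    rw [intervalIntegral.integral_add (Continuous.intervalIntegrable (by fun_prop) _ _)
      (Continuous.intervalIntegrable (by fun_prop) _ _), intervalIntegral.integral_const_mul,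
      integral_id, intervalIntegral.integral_const, smul_eq_mul, mul_comm v]
  have hsub : ∫ s in c..d, (f s - A) = (∫ s in c..d, f s) - A * (d - c) := by
    rw [intervalIntegral.integral_sub hfi (Continuous.intervalIntegrable (by fun_prop) _ _),
      intervalIntegral.integral_const, smul_eq_mul, mul_comm A]
  rw [← haff, ← hsub]
  refine (intervalIntegral.abs_integral_le_integral_abs hcd).trans
    (intervalIntegral.integral_mono_on hcd ?_ (Continuous.intervalIntegrable (by fun_prop) _ _) hf)
  exact (hfi.sub (Continuous.intervalIntegrable (by fun_prop) _ _)).abs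

/-- Averaged midpoint–trapezoid inequality on the real line. -/
theorem averaged_midpoint_trapezoid_inequality (a b M : ℝ) (hab : a < b)
    (f f' : ℝ → ℝ)
    (hcont : ContinuousOn f (Set.Icc a b))
    (hderiv : ∀ s ∈ Set.Ioo a b, HasDerivAt f (f' s) s)
    (hbound : ∀ s ∈ Set.Ioo a b, |f' s| ≤ M) :
    |(1 / 2) * ((f a + f b) / 2 + f ((a + b) / 2)) -
        (1 / (b - a)) * ∫ s in a..b, f s| ≤ M * (b - a) / 8 := by
  have hleft : ∀ c d : ℝ, a ≤ c → c ≤ d → d ≤ b →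
      |(∫ s in c..d, f s) - f c * (d - c)| ≤ M * (d - c) ^ 2 / 2 := by
    intro c d hc hcd hd
    refine (abs_integral_sub_const_le_of_affine_bound (u := M) (v := -(M * c)) hcd
      (hcont.mono (Set.Icc_subset_Icc hc hd)) fun s hs => ?_).trans (le_of_eq (by ring))
    have := abs_sub_le_mul_of_abs_hasDerivAt_le hcont hderiv hbound hc hs.1 (hs.2.trans hd)
    linarith
  have hright : ∀ c d : ℝ, a ≤ c → c ≤ d → d ≤ b →
      |(∫ s in c..d, f s) - f d * (d - c)| ≤ M * (d - c) ^ 2 / 2 := by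
    intro c d hc hcd hd
    refine (abs_integral_sub_const_le_of_affine_bound (u := -M) (v := M * d) hcd
      (hcont.mono (Set.Icc_subset_Icc hc hd)) fun s hs => ?_).trans (le_of_eq (by ring))
    have := abs_sub_le_mul_of_abs_hasDerivAt_le hcont hderiv hbound (hc.trans hs.1) hs.2 hd
    rw [abs_sub_comm]
    linarith
  have hint : ∀ c d : ℝ, a ≤ c → c ≤ d → d ≤ b →
      IntervalIntegrable f MeasureTheory.volume c d := fun c d hc hcd hd =>
    (hcont.mono (Set.Icc_subset_Icc hc hd)).intervalIntegrable_of_Icc hcd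
  obtain ⟨h, hh, rfl⟩ : ∃ h : ℝ, 0 < h ∧ b = a + 4 * h :=
    ⟨(b - a) / 4, by linarith, by ring⟩
  have hmid : (a + (a + 4 * h)) / 2 = a + 2 * h := by ring
  have hsplit : ∫ s in a..(a + 4 * h), f s =
      (∫ s in a..(a + h), f s) + (∫ s in (a + h)..(a + 2 * h), f s) +
        (∫ s in (a + 2 * h)..(a + 3 * h), f s) +
        ∫ s in (a + 3 * h)..(a + 4 * h), f s := by
    rw [intervalIntegral.integral_add_adjacent_intervals,
      intervalIntegral.integral_add_adjacent_intervals,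
      intervalIntegral.integral_add_adjacent_intervals] <;>
    apply hint <;> linarith
  have h₁ := abs_le.1 (hleft a (a + h) le_rfl (by linarith) (by linarith))
  have h₂ := abs_le.1 (hright (a + h) (a + 2 * h) (by linarith) (by linarith) (by linarith))
  have h₃ := abs_le.1 (hleft (a + 2 * h) (a + 3 * h) (by linarith) (by linarith) (by linarith))
  have h₄ := abs_le.1 (hright (a + 3 * h) (a + 4 * h) (by linarith) (by linarith) le_rfl)
  have hb : |(f a + f (a + 4 * h) + 2 * f (a + 2 * h)) * h - ∫ s in a..(a + 4 * h), f s| ≤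
      2 * M * h ^ 2 := by
    rw [hsplit, abs_le]
    ring_nf at h₁ h₂ h₃ h₄ ⊢
    constructor <;> linarith
  have hfactor : (1 / 2) * ((f a + f (a + 4 * h)) / 2 + f (a + 2 * h)) -
      (1 / (a + 4 * h - a)) * (∫ s in a..(a + 4 * h), f s) =
      ((f a + f (a + 4 * h) + 2 * f (a + 2 * h)) * h - ∫ s in a..(a + 4 * h), f s) /
        (4 * h) := by
    rw [add_sub_cancel_left]
    field_simp
    ring
  rw [hmid, hfactor, abs_div, abs_of_pos (by positivity : 0 < 4 * h),
    div_le_iff₀ (by positivity)]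
  linarith
end

section
/- Let n ≥ 1 be a natural number, x₀, x₁, …, x_n real numbers, and M = max_{1 ≤ k ≤ n−1} |x_{k+1} − x_k| (with M = 0 if n = 1). Then for every integer i with 1 ≤ i ≤ n, |x_i − (1/n)·∑_{j=1}^{n} x_j| ≤ (M/n)·( (i − (n+1)/2)² + (n² − 1)/4 ). -/
theorem le_biSup_finset_of_nonneg {ι : Type*} (s : Finset ι) (f : ι → ℝ) (hf : ∀ i, 0 ≤ f i)
    {k : ι} (hk : k ∈ s) : f k ≤ ⨆ i ∈ s, f i := by
  have hbdd : BddAbove (Set.range fun i => ⨆ _ : i ∈ s, f i) := by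
    refine ⟨∑ j ∈ s, f j, ?_⟩
    rintro _ ⟨i, rfl⟩
    exact Real.iSup_le (fun hi => Finset.single_le_sum (fun j _ => hf j) hi)
      (Finset.sum_nonneg fun j _ => hf j)
  have h := le_ciSup hbdd k
  have : Nonempty (k ∈ s) := ⟨hk⟩
  simpa only [ciSup_const] using h

theorem abs_sub_le_mul_of_step_le {x : ℕ → ℝ} {M : ℝ} {a b : ℕ} (hab : a ≤ b)
    (h : ∀ k, a ≤ k → k < b → |x (k + 1) - x k| ≤ M) : |x b - x a| ≤ M * ((b : ℝ) - a) := by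
  induction b, hab using Nat.le_induction with
  | base => simp
  | succ b hab ih =>
    have h₁ := ih fun k hk hkb => h k hk (by omega)
    have h₂ := h b hab (by omega)
    have h₃ := abs_sub_le (x (b + 1)) (x b) (x a)
    push_cast
    linarith

theorem sum_Icc_const_sub (c : ℝ) (m : ℕ) :
    ∑ j ∈ Finset.Icc 1 m, (c - j) = m * c - m * (m + 1) / 2 := by
  induction m with
  | zero => simp
  | succ m ih =>
    rw [Finset.sum_Icc_succ_top (by omega), ih]
    push_cast
    ring

theorem sum_Icc_abs_sub {i n : ℕ} (hin : i ≤ n) :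
    ∑ j ∈ Finset.Icc 1 n, |(i : ℝ) - j| =
      ((i : ℝ) - (n + 1) / 2) ^ 2 + ((n : ℝ) ^ 2 - 1) / 4 := by
  induction n, hin using Nat.le_induction with
  | base =>
    have h : ∀ j ∈ Finset.Icc 1 i, |(i : ℝ) - j| = (i : ℝ) - j := fun j hj =>
      abs_of_nonneg (sub_nonneg.2 (Nat.cast_le.2 (Finset.mem_Icc.1 hj).2))
    rw [Finset.sum_congr rfl h, sum_Icc_const_sub]
    ring
  | succ n hin ih =>
    have h : (i : ℝ) ≤ ((n + 1 : ℕ) : ℝ) := Nat.cast_le.2 (by omega)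
    rw [Finset.sum_Icc_succ_top (by omega), ih, abs_of_nonpos (sub_nonpos.2 h)]
    push_cast
    ring

/-- Discrete Ostrowski inequality. -/
theorem discrete_ostrowski_inequality (n : ℕ) (hn : 1 ≤ n) (x : ℕ → ℝ) (M : ℝ)
    (hM : M = ⨆ k ∈ Finset.Icc 1 (n - 1), |x (k + 1) - x k|)
    (i : ℕ) (hi₁ : 1 ≤ i) (hi₂ : i ≤ n) :
    |x i - (1 / (n : ℝ)) * ∑ j ∈ Finset.Icc 1 n, x j| ≤
      (M / n) * (((i : ℝ) - (n + 1) / 2) ^ 2 + ((n : ℝ) ^ 2 - 1) / 4) := by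
  have hstep : ∀ k, 1 ≤ k → k < n → |x (k + 1) - x k| ≤ M := by
    intro k hk hkn
    rw [hM]
    exact le_biSup_finset_of_nonneg _ (fun k => |x (k + 1) - x k|) (fun _ => abs_nonneg _)
      (Finset.mem_Icc.2 ⟨hk, by omega⟩)
  have hlip : ∀ j ∈ Finset.Icc 1 n, |x i - x j| ≤ M * |(i : ℝ) - j| := by
    intro j hj
    obtain ⟨hj₁, hj₂⟩ := Finset.mem_Icc.1 hj
    rcases le_total j i with hji | hij
    · rw [abs_of_nonneg (sub_nonneg.2 (Nat.cast_le.2 hji))]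
      exact abs_sub_le_mul_of_step_le hji fun k hk hki => hstep k (by omega) (by omega)
    · rw [abs_sub_comm, abs_sub_comm (i : ℝ), abs_of_nonneg (sub_nonneg.2 (Nat.cast_le.2 hij))]
      exact abs_sub_le_mul_of_step_le hij fun k hk hkj => hstep k (by omega) (by omega)
  have hn₀ : (0 : ℝ) < n := Nat.cast_pos.2 hn
  have hmean : x i - (1 / (n : ℝ)) * ∑ j ∈ Finset.Icc 1 n, x j =
      (∑ j ∈ Finset.Icc 1 n, (x i - x j)) / n := by
    rw [Finset.sum_sub_distrib, Finset.sum_const, Nat.card_Icc, nsmul_eq_mul, Nat.add_sub_cancel]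
    field_simp
  rw [hmean, abs_div, abs_of_pos hn₀, ← sum_Icc_abs_sub hi₂, div_mul_eq_mul_div, Finset.mul_sum]
  gcongr
  exact (Finset.abs_sum_le_sum_abs _ _).trans (Finset.sum_le_sum hlip)
end

section
/- Let n ≥ 2 be an even natural number, x₀, x₁, …, x_n real numbers, and M = max_{0 ≤ k ≤ n−1} |x_{k+1} − x_k|. Then |(x₀ + x_n)/2 − (1/n)·∑_{j=1}^{n} x_j| ≤ M·n/4. -/
open Finset in
theorem sum_range_mul_forward_diff (x : ℕ → ℝ) (n : ℕ) :
    ∑ k ∈ range n, (k : ℝ) * (x (k + 1) - x k) = n * x n - ∑ j ∈ Icc 1 n, x j := by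
  induction n with
  | zero => simp
  | succ n ih =>
    rw [sum_range_succ, ih, sum_Icc_succ_top (by omega)]
    push_cast
    ring

open Finset in
theorem sum_range_abs_sub_midpoint (m : ℕ) :
    ∑ k ∈ range (m + m), |(k : ℝ) - m| = (m : ℝ) ^ 2 := by
  rw [sum_range_add, ← sum_add_distrib, sum_congr rfl (g := fun _ => (m : ℝ))]
  · simp [sq]
  · intro k hk
    have hkm : (k : ℝ) ≤ m := by exact_mod_cast (mem_range.mp hk).le
    rw [abs_of_nonpos (by linarith)]
    simp

/-- Discrete trapezoid inequality. -/
theorem discrete_trapezoid_inequality (n : ℕ) (hn : 2 ≤ n) (hne : Even n)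
    (x : ℕ → ℝ) (M : ℝ)
    (hM : M = (Finset.range n).sup'
      (Finset.nonempty_range_iff.mpr (by omega))
      (fun k => |x (k + 1) - x k|)) :
    |(x 0 + x n) / 2 - (1 / (n : ℝ)) * ∑ j ∈ Finset.Icc 1 n, x j| ≤ M * n / 4 := by
  have hΔ : ∀ k ∈ Finset.range n, |x (k + 1) - x k| ≤ M := fun k hk =>
    hM ▸ Finset.le_sup' (fun k => |x (k + 1) - x k|) hk
  obtain ⟨m, rfl⟩ := hne
  have hm : (0 : ℝ) < m := by exact_mod_cast (by omega : 0 < m)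
  have hrepr : (x 0 + x (m + m)) / 2 - (1 / ((m + m : ℕ) : ℝ)) * ∑ j ∈ Finset.Icc 1 (m + m), x j
      = (∑ k ∈ Finset.range (m + m), ((k : ℝ) - m) * (x (k + 1) - x k)) / (2 * m) := by
    simp_rw [sub_mul (_ : ℝ) (m : ℝ)]
    rw [Finset.sum_sub_distrib, ← Finset.mul_sum, Finset.sum_range_sub,
      sum_range_mul_forward_diff]
    push_cast
    field_simp
    ring
  have hsum : |∑ k ∈ Finset.range (m + m), ((k : ℝ) - m) * (x (k + 1) - x k)| ≤ (m : ℝ) ^ 2 * M := by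
    rw [← sum_range_abs_sub_midpoint, Finset.sum_mul]
    refine (Finset.abs_sum_le_sum_abs _ _).trans (Finset.sum_le_sum fun k hk => ?_)
    rw [abs_mul]
    exact mul_le_mul_of_nonneg_left (hΔ k hk) (abs_nonneg _)
  rw [hrepr, abs_div, abs_of_pos (by positivity : (0 : ℝ) < 2 * m), div_le_iff₀ (by positivity)]
  push_cast
  linarith
end

section
/- Let n ≥ 2 be an even natural number, x₀, x₁, …, x_n real numbers, and M = max_{1 ≤ k ≤ n−1} |x_{k+1} − x_k|. Then |x_{n/2} − (1/n)·∑_{j=1}^{n} x_j| ≤ M·n/4. -/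
theorem abs_sub_le_mul_of_abs_succ_sub_le {x : ℕ → ℝ} {M : ℝ} {n : ℕ}
    (h : ∀ k, 1 ≤ k → k < n → |x (k + 1) - x k| ≤ M) {i j : ℕ} (hi : 1 ≤ i) (hij : i ≤ j)
    (hj : j ≤ n) : |x j - x i| ≤ M * ((j : ℝ) - i) := by
  induction j, hij using Nat.le_induction with
  | base => simp
  | succ k hik ih =>
    have h₁ := ih (by omega)
    have h₂ := h k (by omega) (by omega)
    have h₃ := abs_sub_le (x (k + 1)) (x k) (x i)
    push_cast
    linarith

theorem sum_range_const_sub_succ (c : ℝ) (k : ℕ) :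
    ∑ j ∈ Finset.range k, (c - ((j : ℝ) + 1)) = k * c - k * (k + 1) / 2 := by
  induction k with
  | zero => simp
  | succ k ih =>
    rw [Finset.sum_range_succ, ih]
    push_cast
    ring

theorem sum_Icc_abs_sub_midpoint (m : ℕ) :
    ∑ j ∈ Finset.Icc 1 (m + m), |(m : ℝ) - j| = (m : ℝ) ^ 2 := by
  have hfirst : ∑ j ∈ Finset.range m, |(m : ℝ) - ((j + 1 : ℕ) : ℝ)|
      = ∑ j ∈ Finset.range m, ((m : ℝ) - ((j : ℝ) + 1)) :=
    Finset.sum_congr rfl fun j hj => by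
      have hjm : ((j + 1 : ℕ) : ℝ) ≤ m := Nat.cast_le.2 (Finset.mem_range.1 hj)
      rw [abs_of_nonneg (sub_nonneg.2 hjm)]
      push_cast
      ring
  have hsecond : ∑ j ∈ Finset.range m, |(m : ℝ) - ((m + j + 1 : ℕ) : ℝ)|
      = -∑ j ∈ Finset.range m, ((0 : ℝ) - ((j : ℝ) + 1)) := by
    rw [← Finset.sum_neg_distrib]
    refine Finset.sum_congr rfl fun j _ => ?_
    rw [abs_sub_comm, abs_of_nonneg (by push_cast; linarith [(Nat.cast_nonneg j : (0 : ℝ) ≤ j)])]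
    push_cast
    ring
  rw [← Finset.Ico_add_one_right_eq_Icc, Finset.sum_Ico_eq_sum_range,
    Nat.add_sub_cancel]
  simp only [add_comm 1]
  rw [Finset.sum_range_add, hfirst, hsecond, sum_range_const_sub_succ,
    sum_range_const_sub_succ]
  ring

/-- Discrete midpoint inequality. -/
theorem discrete_midpoint_inequality (n : ℕ) (hn : 2 ≤ n) (hne : Even n)
    (x : ℕ → ℝ) (M : ℝ)
    (hM : M = (Finset.Icc 1 (n - 1)).sup'
      (by rw [Finset.nonempty_Icc]; omega)
      (fun k => |x (k + 1) - x k|)) :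
    |x (n / 2) - (1 / (n : ℝ)) * ∑ j ∈ Finset.Icc 1 n, x j| ≤ M * n / 4 := by
  have hstep : ∀ k, 1 ≤ k → k < n → |x (k + 1) - x k| ≤ M := fun k h₁ h₂ => by
    rw [hM]
    exact Finset.le_sup' (fun k => |x (k + 1) - x k|) (Finset.mem_Icc.2 ⟨h₁, by omega⟩)
  obtain ⟨m, rfl⟩ := hne
  have hhalf : (m + m) / 2 = m := by omega
  have hm : (0 : ℝ) < m := by exact_mod_cast (by omega : 0 < m)
  have hterm : ∀ j ∈ Finset.Icc 1 (m + m), |x m - x j| ≤ M * |(m : ℝ) - j| := fun j hj => by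
    obtain ⟨h₁, h₂⟩ := Finset.mem_Icc.1 hj
    rcases le_total j m with hjm | hmj
    · rw [abs_of_nonneg (sub_nonneg.2 (Nat.cast_le.2 hjm) : (0 : ℝ) ≤ m - j)]
      exact abs_sub_le_mul_of_abs_succ_sub_le hstep h₁ hjm (by omega)
    · rw [abs_sub_comm, abs_sub_comm (m : ℝ),
        abs_of_nonneg (sub_nonneg.2 (Nat.cast_le.2 hmj) : (0 : ℝ) ≤ j - m)]
      exact abs_sub_le_mul_of_abs_succ_sub_le hstep (by omega) hmj h₂
  have hsum : |∑ j ∈ Finset.Icc 1 (m + m), (x m - x j)| ≤ M * (m : ℝ) ^ 2 := by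
    rw [← sum_Icc_abs_sub_midpoint, Finset.mul_sum]
    exact (Finset.abs_sum_le_sum_abs _ _).trans (Finset.sum_le_sum hterm)
  have hmean : x m - 1 / ((m + m : ℕ) : ℝ) * ∑ j ∈ Finset.Icc 1 (m + m), x j
      = (∑ j ∈ Finset.Icc 1 (m + m), (x m - x j)) / (m + m) := by
    rw [Finset.sum_sub_distrib, Finset.sum_const, Nat.card_Icc, nsmul_eq_mul,
      Nat.add_sub_cancel]
    push_cast
    field_simp
  rw [hhalf, hmean, abs_div, abs_of_pos (by positivity : (0 : ℝ) < m + m),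
    div_le_iff₀ (by positivity)]
  push_cast
  linarith
end
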